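/- (Verification of Solomon's mechanism) Let I[θ1] be the Solomon interpretation with player 1 as legitimate owner. For the mechanism γ given by 'ch_{1}({x1}); if x1 > 0 then w:=2 else ( ch_{2}({x2}); if x2 > 0 then w:=1 else w:=0 )' and the postcondition Q0 given by the e-predicate (w=1 → o=(1,0,0)) ∧ (w=2 → o=(2,0,0)) ∧ (w=0 → o=(2,ε,M)), the correctness assertion {o=(1,0,0)} γ {Q0} is derivable: I[θ1] ⊢ {o=(1,0,0)} γ {Q0}. -/

import Mathlib

open scoped Classical

noncomputable section

namespace MPL

/-- Terms over variables `V` and function symbols `F` (function symbols applied to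
a stream of arguments; finite arities are modelled by ignoring superfluous arguments). -/
inductive Term (V F : Type) : Type where
  | var : V → Term V F
  | app : F → (ℕ → Term V F) → Term V F

/-- Boolean expressions over variables `V`, function symbols `F` and relation symbols `R`. -/
inductive BExp (V F R : Type) : Type where
  | tt : BExp V F R
  | rel : R → (ℕ → Term V F) → BExp V F R
  | not : BExp V F R → BExp V F R
  | and : BExp V F R → BExp V F R → BExp V F R

/-- MPL mechanisms: assignment, sequential composition, conditional, while-loop,
and simultaneous choice `ch_A(X)` for a finite nonempty set `A` of agents with
distinct choice variables `X a` for `a ∈ A`. -/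
inductive Mech (Ag V F R : Type) : Type where
  | assign : V → Term V F → Mech Ag V F R
  | seq : Mech Ag V F R → Mech Ag V F R → Mech Ag V F R
  | ite : BExp V F R → Mech Ag V F R → Mech Ag V F R → Mech Ag V F R
  | wh : BExp V F R → Mech Ag V F R → Mech Ag V F R
  | choice : (A : Finset Ag) → A.Nonempty → (X : Ag → V) → Set.InjOn X ↑A → Mech Ag V F R

/-- An interpretation: a domain, interpretations of the function and relation symbols,
and for every agent a preference preorder on the domain with a uniformly worst element. -/
structure Interp (Ag V F R : Type) : Type 1 where
  D : Type
  funI : F → (ℕ → D) → D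
  relI : R → (ℕ → D) → Prop
  /-- `pref a d d'` means `d ≥_a d'`. -/
  pref : Ag → D → D → Prop
  pref_refl : ∀ a d, pref a d d
  pref_trans : ∀ a d1 d2 d3, pref a d1 d2 → pref a d2 d3 → pref a d1 d3
  worst : D
  worst_least : ∀ a d, pref a d worst

variable {Ag V F R : Type}

/-- A state assigns a domain element to every mechanism variable. -/
abbrev State (I : Interp Ag V F R) : Type := V → I.D

/-- Value of a term in an interpretation at a state. -/
def Term.eval (I : Interp Ag V F R) (s : State I) : Term V F → I.D
  | .var x => s x
  | .app f ts => I.funI f (fun n => (ts n).eval I s)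

/-- Truth of a boolean expression in an interpretation at a state. -/
def BExp.holds (I : Interp Ag V F R) (s : State I) : BExp V F R → Prop
  | .tt => True
  | .rel r ts => I.relI r (fun n => (ts n).eval I s)
  | .not b => ¬ b.holds I s
  | .and b1 b2 => b1.holds I s ∧ b2.holds I s

/-- A configuration: a mechanism (or `none` for the empty mechanism Λ) together with a state. -/
abbrev Cfg (I : Interp Ag V F R) : Type := Option (Mech Ag V F R) × State I

/-- Update a state at one variable. -/
def updState (I : Interp Ag V F R) (s : State I) (x : V) (d : I.D) : State I :=
  fun y => if y = x then d else s y

/-- The structured operational semantics: labelled transitions `⟨γ,s⟩ →_A ⟨γ',s'⟩`. -/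
inductive Step (I : Interp Ag V F R) : Cfg I → Set Ag → Cfg I → Prop where
  | assign (x : V) (t : Term V F) (s : State I) :
      Step I (some (.assign x t), s) ∅ (none, updState I s x (t.eval I s))
  | choice (A : Finset Ag) (hA : A.Nonempty) (X : Ag → V) (hX : Set.InjOn X ↑A)
      (s s' : State I) (hagree : ∀ y : V, (∀ a ∈ A, X a ≠ y) → s' y = s y) :
      Step I (some (.choice A hA X hX), s) ↑A (none, s')
  | seqFin {γ1 γ2 s L s'} : Step I (some γ1, s) L (none, s') →
      Step I (some (.seq γ1 γ2), s) L (some γ2, s')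
  | seqStep {γ1 γ2 s L γ1' s'} : Step I (some γ1, s) L (some γ1', s') →
      Step I (some (.seq γ1 γ2), s) L (some (.seq γ1' γ2), s')
  | iteT {B γ1 γ2 s} : B.holds I s → Step I (some (.ite B γ1 γ2), s) ∅ (some γ1, s)
  | iteF {B γ1 γ2 s} : ¬ B.holds I s → Step I (some (.ite B γ1 γ2), s) ∅ (some γ2, s)
  | whF {B γ s} : ¬ B.holds I s → Step I (some (.wh B γ), s) ∅ (none, s)
  | whT {B γ s} : B.holds I s → Step I (some (.wh B γ), s) ∅ (some (.seq γ (.wh B γ)), s)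

/-- A (partial) history of the game rooted at `c0`: a nonempty finite sequence of
configurations starting at `c0` and linked by transitions. -/
def IsHist (I : Interp Ag V F R) (c0 : Cfg I) (h : List (Cfg I)) : Prop :=
  h.head? = some c0 ∧ h.Chain' (fun c c' => ∃ L, Step I c L c')

/-- A strategy profile: for every agent a strategy assigning a chosen value to each history. -/
abbrev Profile (I : Interp Ag V F R) : Type := Ag → List (Cfg I) → I.D

/-- The state resulting from the agents in `A` choosing values for their variables
`X a` according to the profile `σ` at history `h`. -/
def chooseVal (I : Interp Ag V F R) (A : Finset Ag) (X : Ag → V) (σ : Profile I)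
    (h : List (Cfg I)) (s : State I) : State I :=
  fun y => if hy : ∃ a, a ∈ A ∧ X a = y then σ hy.choose h else s y

/-- The successor configuration of a (non-empty) configuration, as determined by the
operational semantics together with the choices prescribed by the profile `σ` at history `h`. -/
def next (I : Interp Ag V F R) (σ : Profile I) (h : List (Cfg I)) :
    Mech Ag V F R → State I → Cfg I
  | .assign x t, s => (none, updState I s x (t.eval I s))
  | .choice A _ X _, s => (none, chooseVal I A X σ h s)
  | .seq γ1 γ2, s =>
      match next I σ h γ1 s with
      | (none, s') => (some γ2, s')
      | (some γ1', s') => (some (.seq γ1' γ2), s')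
  | .ite B γ1 γ2, s => if B.holds I s then (some γ1, s) else (some γ2, s)
  | .wh B γ, s => if B.holds I s then (some (.seq γ (.wh B γ)), s) else (none, s)

/-- Extend a history by one step of play according to `σ` (histories ending in Λ stay put). -/
def extend (I : Interp Ag V F R) (σ : Profile I) (h : List (Cfg I)) : List (Cfg I) :=
  match h.getLast? with
  | some (some γ, s) => h ++ [next I σ h γ s]
  | _ => h

/-- The history of the unique run determined by profile `σ` from `c0`, after `n` steps. -/
def runH (I : Interp Ag V F R) (c0 : Cfg I) (σ : Profile I) : ℕ → List (Cfg I)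
  | 0 => [c0]
  | n + 1 => extend I σ (runH I c0 σ n)

/-- A run: the (possibly infinite) sequence of configurations of a maximal play. -/
abbrev Run (I : Interp Ag V F R) : Type := ℕ → Option (Cfg I)

/-- The unique maximal run determined by profile `σ` from initial configuration `c0`. -/
def runOf (I : Interp Ag V F R) (c0 : Cfg I) (σ : Profile I) : Run I :=
  fun n => (runH I c0 σ n)[n]?

/-- `run(σ)` is finite (reaches the empty mechanism Λ). -/
def Terminates (I : Interp Ag V F R) (c0 : Cfg I) (σ : Profile I) : Prop :=
  ∃ n, ∃ s : State I, (runH I c0 σ n).getLast? = some ((none : Option (Mech Ag V F R)), s)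

/-- The final state `s_σ` of a finite run. -/
def finalState (I : Interp Ag V F R) {c0 : Cfg I} {σ : Profile I}
    (h : Terminates I c0 σ) : State I :=
  h.choose_spec.choose

/-- An outcome function assigns an element of the domain to every terminal history
(represented by the corresponding run). -/
abbrev OutcomeF (I : Interp Ag V F R) : Type := Run I → I.D

/-- An extended predicate (e-predicate): a set of pairs (state, outcome). -/
abbrev EPred (I : Interp Ag V F R) : Type := Set (State I × I.D)

/-- `ô ∈ Ô_Q`: every finite run is assigned an outcome satisfying `Q` at its final state. -/
def memOhat (I : Interp Ag V F R) (c0 : Cfg I) (Q : EPred I) (oh : OutcomeF I) : Prop :=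
  ∀ σ : Profile I, ∀ ht : Terminates I c0 σ, (finalState I ht, oh (runOf I c0 σ)) ∈ Q

/-- `σ` is a Nash equilibrium in the game rooted at `c0` with outcome function `oh`. -/
def NashEq (I : Interp Ag V F R) (c0 : Cfg I) (oh : OutcomeF I) (σ : Profile I) : Prop :=
  ∀ (i : Ag) (τ : Profile I), (∀ j, j ≠ i → τ j = σ j) →
    I.pref i (oh (runOf I c0 σ)) (oh (runOf I c0 τ))

/-- Prepend a finite sequence of configurations to a run. -/
def prependRun (I : Interp Ag V F R) (l : List (Cfg I)) (ρ : Run I) : Run I :=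
  fun n => if hn : n < l.length then some l[n] else ρ (n - l.length)

/-- Restriction of an outcome function to the subgame reached via history `h`. -/
def restrictO (I : Interp Ag V F R) (h : List (Cfg I)) (oh : OutcomeF I) : OutcomeF I :=
  fun ρ => oh (prependRun I h.dropLast ρ)

/-- Restriction of a strategy profile to the subgame reached via history `h`. -/
def restrictP (I : Interp Ag V F R) (h : List (Cfg I)) (σ : Profile I) : Profile I :=
  fun a h' => σ a (h.dropLast ++ h')

/-- `σ` is a subgame-perfect equilibrium in `G(γ,s,I,oh)`: its restriction to every
subgame (rooted at any configuration reachable from `⟨γ,s⟩`) is a Nash equilibrium there. -/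
def SPE (I : Interp Ag V F R) (γ : Mech Ag V F R) (s : State I)
    (oh : OutcomeF I) (σ : Profile I) : Prop :=
  ∀ (h : List (Cfg I)) (c : Cfg I), IsHist I (some γ, s) h → h.getLast? = some c →
    NashEq I c (restrictO I h oh) (restrictP I h σ)

/-- The correctness assertion `I ⊨ {P} γ {Q}`. -/
def Valid (I : Interp Ag V F R) (P : EPred I) (γ : Mech Ag V F R) (Q : EPred I) : Prop :=
  ∀ so ∈ P, ∃ (oh : OutcomeF I) (σ : Profile I),
    memOhat I (some γ, so.1) Q oh ∧ SPE I γ so.1 oh σ ∧ oh (runOf I (some γ, so.1) σ) = so.2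

/-- The weakest precondition `wpre(γ,Q,I)`. -/
def wpre (I : Interp Ag V F R) (γ : Mech Ag V F R) (Q : EPred I) : EPred I :=
  {so | ∃ (oh : OutcomeF I) (σ : Profile I),
    memOhat I (some γ, so.1) Q oh ∧ SPE I γ so.1 oh σ ∧ oh (runOf I (some γ, so.1) σ) = so.2}

/-- The substituted e-predicate `Q[x/t]`. -/
def substPred (I : Interp Ag V F R) (Q : EPred I) (x : V) (t : Term V F) : EPred I :=
  {so | (updState I so.1 x (t.eval I so.1), so.2) ∈ Q}

/-- `B^I ∩ P`. -/
def gate (I : Interp Ag V F R) (B : BExp V F R) (P : EPred I) : EPred I :=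
  {so | so ∈ P ∧ B.holds I so.1}

/-- `(¬B)^I ∩ P`. -/
def gateN (I : Interp Ag V F R) (B : BExp V F R) (P : EPred I) : EPred I :=
  {so | so ∈ P ∧ ¬ B.holds I so.1}

/-- The Hoare-style calculus for mechanisms: `I ⊢ {P} γ {Q}`. -/
inductive Deriv (I : Interp Ag V F R) : EPred I → Mech Ag V F R → EPred I → Prop where
  | assign (Q : EPred I) (x : V) (t : Term V F) :
      Deriv I (substPred I Q x t) (.assign x t) Q
  | choice (A : Finset Ag) (hA : A.Nonempty) (X : Ag → V) (hX : Set.InjOn X ↑A)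
      (Q : EPred I) :
      Deriv I (wpre I (.choice A hA X hX) Q) (.choice A hA X hX) Q
  | comp {P R' Q : EPred I} {γ1 γ2 : Mech Ag V F R} :
      Deriv I P γ1 R' → Deriv I R' γ2 Q → Deriv I P (.seq γ1 γ2) Q
  | ifR {P Q : EPred I} {B : BExp V F R} {γ1 γ2 : Mech Ag V F R} :
      Deriv I (gate I B P) γ1 Q → Deriv I (gateN I B P) γ2 Q →
      Deriv I P (.ite B γ1 γ2) Q
  | whileR {P : EPred I} {B : BExp V F R} {γ : Mech Ag V F R} :
      Deriv I (gate I B P) γ P → Deriv I P (.wh B γ) (gateN I B P)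
  | conseq {P P' Q Q' : EPred I} {γ : Mech Ag V F R} :
      P ⊆ P' → Deriv I P' γ Q' → Q' ⊆ Q → Deriv I P γ Q

/-- The Nash-equilibrium variant of validity. -/
def NashValid (I : Interp Ag V F R) (P : EPred I) (γ : Mech Ag V F R) (Q : EPred I) : Prop :=
  ∀ so ∈ P, ∃ (oh : OutcomeF I) (σ : Profile I),
    memOhat I (some γ, so.1) Q oh ∧ NashEq I (some γ, so.1) oh σ ∧
    oh (runOf I (some γ, so.1) σ) = so.2

/-- Mechanisms without any `ch_A` construct, i.e. ordinary programs (MPL(PRG)). -/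
def ChoiceFree : Mech Ag V F R → Prop
  | .assign _ _ => True
  | .seq γ1 γ2 => ChoiceFree γ1 ∧ ChoiceFree γ2
  | .ite _ γ1 γ2 => ChoiceFree γ1 ∧ ChoiceFree γ2
  | .wh _ γ => ChoiceFree γ
  | .choice _ _ _ _ => False

/-- Standard Hoare partial correctness: every finite maximal execution of `γ`
from a state in `P` terminates in a state in `Q`. -/
def HoarePartial (I : Interp Ag V F R) (P : Set (State I)) (γ : Mech Ag V F R)
    (Q : Set (State I)) : Prop :=
  ∀ s ∈ P, ∀ (h : List (Cfg I)) (t : State I),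
    IsHist I (some γ, s) h → h.getLast? = some ((none : Option (Mech Ag V F R)), t) → t ∈ Q

end MPL

namespace MPL

/-- The domain of the Solomon interpretation: the reals, all triples `(x,m1,m2)` with
`x ∈ {0,1,2}` and `m1,m2 ∈ ℝ`, and a uniformly worst element. -/
inductive SolD : Type where
  | real : ℝ → SolD
  | triple : Fin 3 → ℝ → ℝ → SolD
  | bot : SolD

/-- Mechanism variables for Solomon's mechanism. -/
inductive SolV : Type where
  | x1 | x2 | w
deriving DecidableEq

/-- Function symbols: the constants 0, 1, 2. -/
inductive SolF : Type where
  | czero | cone | ctwo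
deriving DecidableEq

/-- Relation symbols: `pos t` means `t > 0`. -/
inductive SolR : Type where
  | pos
deriving DecidableEq

/-- The agents: players 1 and 2. -/
abbrev SolAg : Type := Fin 2

/-- Player `i`'s payoff at an outcome: at a triple `(x,m1,m2)`, player 1 gets
`(vH if x=1 else 0) − m1` and player 2 gets `(vL if x=2 else 0) − m2`. -/
def solPay (vH vL : ℝ) (i : SolAg) : SolD → ℝ
  | .real r => r
  | .triple x m1 m2 =>
      if i = 0 then (if x = 1 then vH else 0) - m1 else (if x = 2 then vL else 0) - m2
  | .bot => 0

/-- Player `i`'s preference: `d ≥_i d'` iff `d'` is the worst element, or neither is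
worst and `i`'s payoff at `d` is at least `i`'s payoff at `d'`. -/
def solPref (vH vL : ℝ) (i : SolAg) (d d' : SolD) : Prop :=
  d' = SolD.bot ∨ (d ≠ SolD.bot ∧ solPay vH vL i d' ≤ solPay vH vL i d)

/-- The Solomon interpretation `I[θ1]` (player 1, with valuation `vH`, is the
legitimate owner; player 2 has valuation `vL`). -/
def solInterp (vH vL : ℝ) : Interp SolAg SolV SolF SolR where
  D := SolD
  funI f _ := match f with
    | .czero => SolD.real 0
    | .cone => SolD.real 1
    | .ctwo => SolD.real 2
  relI _ args := ∃ r : ℝ, args 0 = SolD.real r ∧ 0 < r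
  pref := solPref vH vL
  pref_refl := by
    intro a d
    by_cases h : d = SolD.bot
    · exact Or.inl h
    · exact Or.inr ⟨h, le_refl _⟩
  pref_trans := by
    intro a d1 d2 d3 h12 h23
    rcases h23 with h | ⟨h2ne, hle23⟩
    · exact Or.inl h
    · rcases h12 with h | ⟨h1ne, hle12⟩
      · exact absurd h h2ne
      · exact Or.inr ⟨h1ne, le_trans hle23 hle12⟩
  worst := SolD.bot
  worst_least := fun _ _ => Or.inl rfl

/-- The boolean expression `x > 0` for a variable `x`. -/
def solPos (x : SolV) : BExp SolV SolF SolR :=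
  BExp.rel SolR.pos (fun _ => Term.var x)

/-- The constant term interpreted as the real `k` (for `k = 0,1,2`). -/
def solConst (f : SolF) : Term SolV SolF :=
  Term.app f (fun _ => Term.var SolV.w)

/-- Solomon's mechanism:
`ch_{1}({x1}); if x1 > 0 then w:=2 else ( ch_{2}({x2}); if x2 > 0 then w:=1 else w:=0 )`. -/
def solMech : Mech SolAg SolV SolF SolR :=
  .seq
    (.choice {0} (Finset.singleton_nonempty 0) (fun _ => SolV.x1)
      (by
        intro a ha b hb _
        simp only [Finset.coe_singleton, Set.mem_singleton_iff] at ha hb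
        rw [ha, hb]))
    (.ite (solPos SolV.x1)
      (.assign SolV.w (solConst SolF.ctwo))
      (.seq
        (.choice {1} (Finset.singleton_nonempty 1) (fun _ => SolV.x2)
          (by
            intro a ha b hb _
            simp only [Finset.coe_singleton, Set.mem_singleton_iff] at ha hb
            rw [ha, hb]))
        (.ite (solPos SolV.x2)
          (.assign SolV.w (solConst SolF.cone))
          (.assign SolV.w (solConst SolF.czero)))))

/-- The postcondition `Q0`:
`(w=1 → o=(1,0,0)) ∧ (w=2 → o=(2,0,0)) ∧ (w=0 → o=(2,ε,M))`. -/
def solPost (vH vL ε M : ℝ) : EPred (solInterp vH vL) :=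
  {so | (so.1 SolV.w = SolD.real 1 → so.2 = SolD.triple 1 0 0) ∧
        (so.1 SolV.w = SolD.real 2 → so.2 = SolD.triple 2 0 0) ∧
        (so.1 SolV.w = SolD.real 0 → so.2 = SolD.triple 2 ε M)}

/-- The precondition `o = (1,0,0)`. -/
def solPre (vH vL : ℝ) : EPred (solInterp vH vL) :=
  {so | so.2 = SolD.triple 1 0 0}

section SingleChoice

variable {Ag V F R : Type} {I : Interp Ag V F R}

theorem chooseVal_singleton (a : Ag) (x : V) (σ : Profile I) (h : List (Cfg I)) (s : State I) :
    chooseVal I {a} (fun _ => x) σ h s = updState I s x (σ a h) := by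
  funext y
  by_cases hy : x = y
  · have hex : ∃ b, b ∈ ({a} : Finset Ag) ∧ x = y := ⟨a, Finset.mem_singleton_self a, hy⟩
    have hb : hex.choose = a := Finset.mem_singleton.mp hex.choose_spec.1
    simp only [chooseVal, updState, dif_pos hex, hb, if_pos hy.symm]
  · have hne : ¬ ∃ b, b ∈ ({a} : Finset Ag) ∧ x = y := fun ⟨_, _, h⟩ => hy h
    simp only [chooseVal, updState, dif_neg hne, if_neg (Ne.symm hy)]

theorem runH_none (s : State I) (σ : Profile I) (n : ℕ) :
    runH I ((none : Option (Mech Ag V F R)), s) σ n = [(none, s)] := by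
  induction n with
  | zero => rfl
  | succ n ih => simp [runH, ih, extend]

theorem nashEq_none (s : State I) (oh : OutcomeF I) (σ : Profile I) :
    NashEq I ((none : Option (Mech Ag V F R)), s) oh σ := by
  intro i τ _
  have hrun : runOf I ((none : Option (Mech Ag V F R)), s) σ = runOf I (none, s) τ := by
    funext n
    simp only [runOf, runH_none]
  rw [hrun]
  exact I.pref_refl _ _

theorem runH_choice_succ (a : Ag) (x : V) (hA : ({a} : Finset Ag).Nonempty)
    (hX : Set.InjOn (fun _ : Ag => x) ↑({a} : Finset Ag)) (s : State I) (σ : Profile I) (n : ℕ) :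
    runH I (some (.choice {a} hA (fun _ => x) hX), s) σ (n + 1) =
      [(some (.choice {a} hA (fun _ => x) hX), s),
        (none, updState I s x (σ a [(some (.choice {a} hA (fun _ => x) hX), s)]))] := by
  induction n with
  | zero => simp [runH, extend, next, chooseVal_singleton]
  | succ n ih => rw [runH, ih]; simp [extend]

/-- The outcome function reading the outcome off the state reached after one step. -/
def oneStepOutcome (g : State I → I.D) : OutcomeF I :=
  fun ρ => match ρ 1 with
    | some c => g c.2
    | none => I.worst

theorem oneStepOutcome_choice (g : State I → I.D) (a : Ag) (x : V)
    (hA : ({a} : Finset Ag).Nonempty)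
    (hX : Set.InjOn (fun _ : Ag => x) ↑({a} : Finset Ag)) (s : State I) (σ : Profile I) :
    oneStepOutcome g (runOf I (some (.choice {a} hA (fun _ => x) hX), s) σ) =
      g (updState I s x (σ a [(some (.choice {a} hA (fun _ => x) hX), s)])) := by
  have h := runH_choice_succ a x hA hX s σ 0
  simp only [zero_add] at h
  simp [oneStepOutcome, runOf, h]

theorem hist_choice {A : Finset Ag} {hA : A.Nonempty} {X : Ag → V} {hX : Set.InjOn X ↑A}
    {s : State I} {h : List (Cfg I)} {c : Cfg I}
    (hh : IsHist I (some (.choice A hA X hX), s) h) (hc : h.getLast? = some c) :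
    h = [(some (.choice A hA X hX), s)] ∨ c.1 = none := by
  obtain ⟨hhead, hchain⟩ := hh
  match h, hhead, hchain, hc with
  | [d], hhead, _, _ => left; simpa using hhead
  | [d, e], hhead, hchain, hc =>
    right
    simp only [List.head?_cons, Option.some.injEq] at hhead
    simp only [List.getLast?_cons_cons, List.getLast?_singleton, Option.some.injEq] at hc
    subst hhead hc
    obtain ⟨L, hstep⟩ := (List.isChain_cons_cons.mp hchain).1
    cases hstep
    rfl
  | d :: e :: f :: t, hhead, hchain, _ =>
    simp only [List.head?_cons, Option.some.injEq] at hhead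
    subst hhead
    obtain ⟨⟨L, hstep⟩, htail⟩ := List.isChain_cons_cons.mp hchain
    obtain ⟨⟨L', hstep'⟩, _⟩ := List.isChain_cons_cons.mp htail
    cases hstep
    cases hstep'

/-- If `g` assigns `Q`-admissible outcomes to the states reachable by a single agent's choice and
`d` is an optimal value for that agent, then the resulting outcome is in the weakest
precondition. -/
theorem mem_wpre_choice_singleton {Q : EPred I} (g : State I → I.D) (a : Ag) (x : V)
    (hA : ({a} : Finset Ag).Nonempty)
    (hX : Set.InjOn (fun _ : Ag => x) ↑({a} : Finset Ag)) (s : State I) (d : I.D)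
    (hQ : ∀ d', (updState I s x d', g (updState I s x d')) ∈ Q)
    (hopt : ∀ d', I.pref a (g (updState I s x d)) (g (updState I s x d'))) :
    (s, g (updState I s x d)) ∈ wpre I (.choice {a} hA (fun _ => x) hX) Q := by
  refine ⟨oneStepOutcome g, fun _ _ => d, ?_, ?_, oneStepOutcome_choice g a x hA hX s _⟩
  · intro σ ht
    have hfin := ht.choose_spec.choose_spec
    change _ = some (none, finalState I ht) at hfin
    rw [oneStepOutcome_choice]
    rcases hn : ht.choose with _ | n
    · rw [hn] at hfin
      simp [runH] at hfin
    · rw [hn, runH_choice_succ] at hfin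
      simp only [List.getLast?_cons_cons, List.getLast?_singleton, Option.some.injEq,
        Prod.mk.injEq, true_and] at hfin
      rw [← hfin]
      exact hQ _
  · intro h c hh hc
    rcases hist_choice hh hc with rfl | hnone
    · simp only [List.getLast?_singleton, Option.some.injEq] at hc
      subst hc
      intro i τ hτ
      change I.pref i (oneStepOutcome g _) (oneStepOutcome g (runOf I _ τ))
      have hprep : ∀ ρ : Run I, prependRun I [] ρ = ρ := fun ρ => by
        funext n
        simp [prependRun]
      simp only [List.dropLast_singleton, hprep]
      rw [oneStepOutcome_choice, oneStepOutcome_choice]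
      by_cases hi : a = i
      · subst hi
        exact hopt _
      · rw [hτ a hi]
        exact I.pref_refl _ _
    · obtain ⟨m, s'⟩ := c
      subst hnone
      exact nashEq_none _ _ _

end SingleChoice

theorem updState_self {Ag V F R : Type} (I : Interp Ag V F R) (s : State I) (x : V) (d : I.D) :
    updState I s x d x = d :=
  if_pos rfl

theorem solPos_holds_updState (vH vL : ℝ) (s : State (solInterp vH vL)) (x : SolV) (d : SolD) :
    (solPos x).holds (solInterp vH vL) (updState (solInterp vH vL) s x d) ↔
      ∃ r : ℝ, d = SolD.real r ∧ 0 < r := by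
  have h : updState (solInterp vH vL) s x d x = d := updState_self _ _ _ _
  exact ⟨fun ⟨r, hr, hpos⟩ => ⟨r, h.symm.trans hr, hpos⟩,
    fun ⟨r, hr, hpos⟩ => ⟨r, h.trans hr, hpos⟩⟩

/-- The e-predicate forcing outcome `p` when `x > 0` and `q` otherwise. -/
def branchPred (vH vL : ℝ) (x : SolV) (p q : SolD) : EPred (solInterp vH vL) :=
  {so | so.2 = if (solPos x).holds (solInterp vH vL) so.1 then p else q}

/-- Player `i`, choosing the value of `x`, secures the outcome of the positive branch if he
weakly prefers it. -/
theorem mem_wpre_branchPred_pos {vH vL : ℝ} {i : SolAg} {x : SolV} {p q : SolD}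
    (hA : ({i} : Finset SolAg).Nonempty)
    (hX : Set.InjOn (fun _ : SolAg => x) ↑({i} : Finset SolAg))
    (hpq : (solInterp vH vL).pref i p q) (s : State (solInterp vH vL)) :
    (s, p) ∈ wpre (solInterp vH vL) (.choice {i} hA (fun _ => x) hX)
      (branchPred vH vL x p q) := by
  let g : State (solInterp vH vL) → SolD :=
    fun t => if (solPos x).holds (solInterp vH vL) t then p else q
  have hg : g (updState (solInterp vH vL) s x (SolD.real 1)) = p :=
    if_pos ((solPos_holds_updState vH vL s x _).mpr ⟨1, rfl, one_pos⟩)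
  have key := mem_wpre_choice_singleton (I := solInterp vH vL) (Q := branchPred vH vL x p q)
    g i x hA hX s (SolD.real 1) (fun _ => rfl) (fun d' => by
      rw [hg]
      by_cases h : (solPos x).holds (solInterp vH vL) (updState (solInterp vH vL) s x d')
      · simp only [g, if_pos h]
        exact (solInterp vH vL).pref_refl _ _
      · simp only [g, if_neg h]
        exact hpq)
  rwa [hg] at key

/-- Player `i`, choosing the value of `x`, secures the outcome of the non-positive branch if he
weakly prefers it. -/
theorem mem_wpre_branchPred_not_pos {vH vL : ℝ} {i : SolAg} {x : SolV} {p q : SolD}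
    (hA : ({i} : Finset SolAg).Nonempty)
    (hX : Set.InjOn (fun _ : SolAg => x) ↑({i} : Finset SolAg))
    (hqp : (solInterp vH vL).pref i q p) (s : State (solInterp vH vL)) :
    (s, q) ∈ wpre (solInterp vH vL) (.choice {i} hA (fun _ => x) hX)
      (branchPred vH vL x p q) := by
  let g : State (solInterp vH vL) → SolD :=
    fun t => if (solPos x).holds (solInterp vH vL) t then p else q
  have hg : g (updState (solInterp vH vL) s x SolD.bot) = q :=
    if_neg (by simp [solPos_holds_updState])
  have key := mem_wpre_choice_singleton (I := solInterp vH vL) (Q := branchPred vH vL x p q)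
    g i x hA hX s SolD.bot (fun _ => rfl) (fun d' => by
      rw [hg]
      by_cases h : (solPos x).holds (solInterp vH vL) (updState (solInterp vH vL) s x d')
      · simp only [g, if_pos h]
        exact hqp
      · simp only [g, if_neg h]
        exact (solInterp vH vL).pref_refl _ _)
  rwa [hg] at key

theorem deriv_assign_const {vH vL : ℝ} {P Q : EPred (solInterp vH vL)} (f : SolF)
    (h : ∀ so ∈ P, (updState (solInterp vH vL) so.1 SolV.w
      ((solInterp vH vL).funI f fun _ => so.1 SolV.w), so.2) ∈ Q) :
    Deriv (solInterp vH vL) P (.assign SolV.w (solConst f)) Q :=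
  .conseq h (.assign Q SolV.w (solConst f)) subset_rfl

theorem mem_solPost {vH vL ε M : ℝ} {s : State (solInterp vH vL)} {o d : SolD}
    (hw : s SolV.w = d)
    (h : (d = SolD.real 1 → o = SolD.triple 1 0 0) ∧ (d = SolD.real 2 → o = SolD.triple 2 0 0) ∧
      (d = SolD.real 0 → o = SolD.triple 2 ε M)) :
    (s, o) ∈ solPost vH vL ε M := by
  subst hw
  exact h

/-- Verification of Solomon's mechanism: with `0 < ε` and `0 < vL < M < vH`
(player 1 the legitimate owner), the assertion `{o=(1,0,0)} γ {Q0}` is derivable. -/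
theorem solomon_verification (vH vL M ε : ℝ)
    (hε : 0 < ε) (h1 : 0 < vL) (h2 : vL < M) (h3 : M < vH) :
    Deriv (solInterp vH vL) (solPre vH vL) solMech (solPost vH vL ε M) := by
  refine .comp (R' := branchPred vH vL SolV.x1 (.triple 2 0 0) (.triple 1 0 0))
    (.conseq ?_ (.choice _ _ _ _ _) subset_rfl) (.ifR (deriv_assign_const _ ?_)
      (.comp (R' := branchPred vH vL SolV.x2 (.triple 1 0 0) (.triple 2 ε M))
        (.conseq ?_ (.choice _ _ _ _ _) subset_rfl)
        (.ifR (deriv_assign_const _ ?_) (deriv_assign_const _ ?_))))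
  · rintro ⟨s, o⟩ ho
    obtain rfl : o = SolD.triple 1 0 0 := ho
    refine mem_wpre_branchPred_not_pos _ _ (Or.inr ⟨by simp, ?_⟩) s
    simp [solPay]
    linarith
  · rintro ⟨s, o⟩ ⟨ho, hB⟩
    obtain rfl : o = SolD.triple 2 0 0 := ho.trans (if_pos hB)
    exact mem_solPost (d := .real 2) (updState_self _ _ _ _) (by simp)
  · rintro ⟨s, o⟩ ⟨ho, hB⟩
    obtain rfl : o = SolD.triple 1 0 0 := ho.trans (if_neg hB)
    refine mem_wpre_branchPred_pos _ _ (Or.inr ⟨by simp, ?_⟩) s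
    simp [solPay]
    linarith
  · rintro ⟨s, o⟩ ⟨ho, hB⟩
    obtain rfl : o = SolD.triple 1 0 0 := ho.trans (if_pos hB)
    exact mem_solPost (d := .real 1) (updState_self _ _ _ _) (by simp)
  · rintro ⟨s, o⟩ ⟨ho, hB⟩
    obtain rfl : o = SolD.triple 2 ε M := ho.trans (if_neg hB)
    exact mem_solPost (d := .real 0) (updState_self _ _ _ _) (by simp)

end MPL
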